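/- arXiv:1211.0181 — 6 statements merged into one kernel-verified Lean document; each statement's English description precedes it below -/
import Mathlib

section
/- Let μ ∈ ∂Γ^σ. Then Θ_R(μ) is nondecreasing in R on (|μ|, ∞). Moreover, if Θ_{R₀}(μ) > 0 for some R₀ ≥ |μ|, then Θ_{R'}(μ) > Θ_R(μ) for all R' > R ≥ R₀; that is, Θ_R(μ) is strictly increasing in R beyond R₀. -/
open Filter Set

noncomputable def euclNorm {n : ℕ} (x : Fin n → ℝ) : ℝ := Real.sqrt (∑ i, x i ^ 2)

/-- The `i`-th partial derivative `f_i = ∂f/∂λ_i`. -/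
noncomputable def pd {n : ℕ} (f : (Fin n → ℝ) → ℝ) (x : Fin n → ℝ) (i : Fin n) : ℝ :=
  fderiv ℝ f x (Pi.single i 1)

/-- `Θ_R(μ) = inf_{λ ∈ ∂B_R(0) ∩ ∂Γ^σ} max_{0 ≤ t ≤ 1} (f(tμ + (1-t)λ) - σ)`. -/
noncomputable def Theta {n : ℕ} (Γ : Set (Fin n → ℝ)) (f : (Fin n → ℝ) → ℝ) (σ : ℝ)
    (μ : Fin n → ℝ) (R : ℝ) : ℝ :=
  sInf ((fun l => sSup ((fun t : ℝ => f (t • μ + (1 - t) • l) - σ) '' Set.Icc 0 1)) ''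
    {l | euclNorm l = R ∧ l ∈ Γ ∧ f l = σ})


theorem exists_continuous_height {ι : Type*} [Fintype ι] {C : Set (ι → ℝ)} (hclosed : IsClosed C)
    (hup : IsUpperSet C) (hne : C.Nonempty) (huniv : C ≠ univ) :
    ∃ h : (ι → ℝ) → ℝ, Continuous h ∧ ∀ x s, x - (fun _ => s) ∈ C ↔ s ≤ h x := by
  have hcoord (x y : ι → ℝ) (i : ι) : y i ≤ x i + dist x y := by
    have h := dist_le_pi_dist x y i
    rw [Real.dist_eq] at h
    linarith [(abs_le.1 h).1]
  set A : (ι → ℝ) → Set ℝ := fun x => {s | x - (fun _ => s) ∈ C} with hA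
  have hAne (x) : (A x).Nonempty := by
    obtain ⟨c, hc⟩ := hne
    refine ⟨-dist x c, hup (fun i => ?_) hc⟩
    have := hcoord x c i
    simp only [Pi.sub_apply]
    linarith
  have hAbdd (x) : BddAbove (A x) := by
    by_contra hb
    rw [not_bddAbove_iff] at hb
    refine huniv (eq_univ_of_forall fun y => ?_)
    obtain ⟨s, hs, hlt⟩ := hb (dist x y)
    refine hup (fun i => ?_) hs
    have := hcoord y x i
    rw [dist_comm] at this
    simp only [Pi.sub_apply]
    linarith
  have hAclosed (x) : IsClosed (A x) := hclosed.preimage (by fun_prop)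
  have hmem (x) : x - (fun _ => sSup (A x)) ∈ C := (hAclosed x).csSup_mem (hAne x) (hAbdd x)
  refine ⟨fun x => sSup (A x), ?_, fun x s => ⟨fun hs => le_csSup (hAbdd x) hs, fun hs => ?_⟩⟩
  · refine (LipschitzWith.of_le_add fun x y => ?_).continuous
    have : sSup (A x) - dist x y ∈ A y := by
      refine hup (fun i => ?_) (hmem x)
      have := hcoord y x i
      rw [dist_comm] at this
      simp only [Pi.sub_apply]
      linarith
    linarith [le_csSup (hAbdd y) this]
  · exact hup (fun i => sub_le_sub_left hs (x i)) (hmem x)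

theorem isUpperSet_of_convex_cone {ι : Type*} [Finite ι] {Γ : Set (ι → ℝ)} (hopen : IsOpen Γ)
    (hconv : Convex ℝ Γ) (hcone : ∀ t : ℝ, 0 < t → ∀ x ∈ Γ, t • x ∈ Γ)
    (hpos : {x : ι → ℝ | ∀ i, 0 < x i} ⊆ Γ) : IsUpperSet Γ := by
  intro x y hxy hx
  have hev : ∀ᶠ s in nhds (0 : ℝ), x - (fun _ => s) ∈ Γ := by
    refine (Continuous.continuousAt (by fun_prop)).eventually_mem (hopen.mem_nhds ?_)
    convert hx using 1
    ext; simp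
  obtain ⟨s, hs, hs0⟩ := ((hev.filter_mono nhdsWithin_le_nhds).and
    (self_mem_nhdsWithin : Ioi (0 : ℝ) ∈ nhdsWithin 0 (Ioi 0))).exists
  have hs0 : 0 < s := hs0
  have hd : y - x + (fun _ => s) ∈ Γ := hpos fun i => by
    have := hxy i
    simp only [Pi.sub_apply, Pi.add_apply]
    linarith
  have h := hconv (hcone 2 two_pos _ hs) (hcone 2 two_pos _ hd)
    (by norm_num : (0 : ℝ) ≤ 1 / 2) (by norm_num : (0 : ℝ) ≤ 1 / 2) (by norm_num)
  convert h using 1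
  ext i
  simp only [Pi.sub_apply, Pi.add_apply, Pi.smul_apply, smul_eq_mul]
  ring

theorem strictMonoOn_of_fderiv_single_pos {ι : Type*} [Fintype ι] [DecidableEq ι]
    {Γ : Set (ι → ℝ)} {f : (ι → ℝ) → ℝ} (hconv : Convex ℝ Γ)
    (hf : ∀ x ∈ Γ, DifferentiableAt ℝ f x)
    (hpos : ∀ x ∈ Γ, ∀ i, 0 < fderiv ℝ f x (Pi.single i 1)) : StrictMonoOn f Γ := by
  intro x hx y hy hxy
  have hmem : ∀ t ∈ Icc (0 : ℝ) 1, x + t • (y - x) ∈ Γ := fun t ht =>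
    hconv.add_smul_sub_mem hx hy ht
  have hderiv : ∀ t ∈ Icc (0 : ℝ) 1, HasDerivAt (fun t : ℝ => f (x + t • (y - x)))
      (fderiv ℝ f (x + t • (y - x)) (y - x)) t := fun t ht => by
    have h : HasDerivAt (fun t : ℝ => x + t • (y - x)) (y - x) t := by
      simpa using ((hasDerivAt_id t).smul_const (y - x)).const_add x
    exact (hf _ (hmem t ht)).hasFDerivAt.comp_hasDerivAt t h
  have hmono : StrictMonoOn (fun t : ℝ => f (x + t • (y - x))) (Icc 0 1) := by
    refine strictMonoOn_of_deriv_pos (convex_Icc 0 1)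
      (fun t ht => (hderiv t ht).continuousAt.continuousWithinAt) fun t ht => ?_
    have ht' := interior_subset ht
    rw [(hderiv t ht').deriv]
    have hsum := LinearMap.pi_apply_eq_sum_univ
      (fderiv ℝ f (x + t • (y - x))).toLinearMap (y - x)
    rw [ContinuousLinearMap.coe_coe] at hsum
    rw [hsum]
    obtain ⟨hle, i, hi⟩ := Pi.lt_def.1 hxy
    have hsingle (j : ι) : (fun k => if j = k then (1 : ℝ) else 0) = Pi.single j 1 := by
      ext k
      simp [Pi.single_apply, eq_comm]
    simp only [hsingle]
    refine Finset.sum_pos' (fun j _ => ?_) ⟨i, Finset.mem_univ i, ?_⟩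
    · exact mul_nonneg (sub_nonneg.2 (hle j)) (hpos _ (hmem t ht') j).le
    · exact mul_pos (sub_pos.2 hi) (hpos _ (hmem t ht') i)
  simpa using hmono (left_mem_Icc.2 zero_le_one) (right_mem_Icc.2 zero_le_one) one_pos

/-- Superlevel sets above the boundary values of a monotone function are closed. -/
theorem isClosed_superlevel {ι : Type*} [Fintype ι] {Γ : Set (ι → ℝ)} {f : (ι → ℝ) → ℝ} {σ : ℝ}
    (hup : IsUpperSet Γ) (hopen : IsOpen Γ) (hcont : ContinuousOn f Γ) (hmono : MonotoneOn f Γ)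
    (hσ : ∀ x ∈ frontier Γ, limsup f (nhdsWithin x Γ) < σ) :
    IsClosed {x | x ∈ Γ ∧ σ ≤ f x} := by
  refine isClosed_of_closure_subset fun x hx => ?_
  have hfreq := mem_closure_iff_frequently.1 hx
  by_cases hxΓ : x ∈ Γ
  · refine ⟨hxΓ, le_of_not_gt fun hlt => hfreq ?_⟩
    filter_upwards [(hcont.continuousAt (hopen.mem_nhds hxΓ)).eventually_lt_const hlt] with y hy
    exact fun h => (h.2.trans_lt hy).false
  · exfalso
    have hxc : x ∈ closure Γ := closure_mono (fun _ h => h.1) hx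
    have hxf : x ∈ frontier Γ := ⟨hxc, by rwa [hopen.interior_eq]⟩
    have hbound : {z : ι → ℝ | ∀ i, z i < x i + 1} ∈ nhds x := by
      simp only [ofPred_forall]
      exact iInter_mem.2 fun i =>
        (continuous_apply i).continuousAt.eventually_lt_const (lt_add_one (x i))
    obtain ⟨z, hz⟩ := (mem_closure_iff_frequently.1 hxc).and_eventually hbound |>.exists
    have hx1 : x + 1 ∈ Γ := hup (fun i => (hz.2 i).le) hz.1
    have hne : {a | ∀ᶠ y in nhdsWithin x Γ, f y ≤ a}.Nonempty := by
      refine ⟨f (x + 1), ?_⟩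
      filter_upwards [self_mem_nhdsWithin, mem_nhdsWithin_of_mem_nhds hbound] with y hy hy1
      exact hmono hy hx1 fun i => (hy1 i).le
    have hlim := hσ x hxf
    rw [limsup_eq] at hlim
    obtain ⟨a, ha, haσ⟩ := exists_lt_of_csInf_lt hne hlim
    refine hfreq ?_
    filter_upwards [eventually_nhdsWithin_iff.1 ha] with y hy
    exact fun h => (h.2.trans_lt ((hy h.1).trans_lt haσ)).false

/-- The level set `{f = σ}` is a graph over the hyperplanes orthogonal to `(1, …, 1)`: every point
has a continuous height above it along that direction. -/
theorem exists_continuous_height_above_level {ι : Type*} [Fintype ι] [Nonempty ι]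
    {Γ : Set (ι → ℝ)} {f : (ι → ℝ) → ℝ} {σ : ℝ} (hup : IsUpperSet Γ) (hopen : IsOpen Γ)
    (huniv : Γ ≠ univ) (hcont : ContinuousOn f Γ) (hmono : StrictMonoOn f Γ)
    (hσ : ∀ x ∈ frontier Γ, limsup f (nhdsWithin x Γ) < σ) (hne : ∃ x ∈ Γ, f x = σ) :
    ∃ h : (ι → ℝ) → ℝ, Continuous h ∧
      (∀ x, x - (fun _ => h x) ∈ Γ ∧ f (x - fun _ => h x) = σ) ∧
      (∀ x ∈ Γ, σ ≤ f x → 0 ≤ h x) ∧ ∀ x ∈ Γ, f x = σ → h x = 0 := by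
  obtain ⟨h, hcts, hh⟩ := exists_continuous_height
    (isClosed_superlevel hup hopen hcont hmono.monotoneOn hσ)
    (fun x y hxy hx => ⟨hup hxy hx.1, hx.2.trans (hmono.monotoneOn hx.1 (hup hxy hx.1) hxy)⟩)
    (by obtain ⟨x, hx, hxσ⟩ := hne; exact ⟨x, hx, hxσ.ge⟩)
    (fun hC => huniv (eq_univ_of_univ_subset (hC ▸ fun _ hx => hx.1)))
  have hnonneg : ∀ x ∈ Γ, σ ≤ f x → 0 ≤ h x := fun x hx hxσ =>
    (hh x 0).1 (by
      have : x - (fun _ => (0 : ℝ)) = x := sub_zero x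
      rw [this]
      exact ⟨hx, hxσ⟩)
  have hmem (x) := (hh x (h x)).2 le_rfl
  refine ⟨h, hcts, fun x => ⟨(hmem x).1, le_antisymm (le_of_not_gt fun hlt => ?_) (hmem x).2⟩,
    hnonneg, fun x hx hxσ => le_antisymm (le_of_not_gt fun hlt => ?_) (hnonneg x hx hxσ.ge)⟩
  · have hc : ContinuousAt (fun s : ℝ => x - fun _ : ι => s) (h x) :=
      Continuous.continuousAt (by fun_prop)
    have hfc : ContinuousAt (fun s : ℝ => f (x - fun _ : ι => s)) (h x) :=
      ContinuousAt.comp (f := fun s : ℝ => x - fun _ : ι => s)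
        (hcont.continuousAt (hopen.mem_nhds (hmem x).1)) hc
    have hev := (hc.eventually_mem (hopen.mem_nhds (hmem x).1)).and (hfc.eventually_const_lt hlt)
    obtain ⟨s, hs, hs0⟩ := ((hev.filter_mono nhdsWithin_le_nhds).and
      (self_mem_nhdsWithin : Ioi (h x) ∈ nhdsWithin (h x) (Ioi (h x)))).exists
    exact ((hh x s).1 ⟨hs.1, hs.2.le⟩).not_gt hs0
  · have hltx : x - (fun _ => h x) < x :=
      sub_lt_self x (Pi.lt_def.2 ⟨fun _ => hlt.le, Classical.arbitrary ι, hlt⟩)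
    exact ((hmem x).2.trans_lt (hmono (hmem x).1 hx hltx)).ne' hxσ

theorem abs_apply_le_euclNorm {n : ℕ} (x : Fin n → ℝ) (i : Fin n) : |x i| ≤ euclNorm x :=
  Real.abs_le_sqrt (Finset.single_le_sum (f := fun i => x i ^ 2) (fun _ _ => sq_nonneg _)
    (Finset.mem_univ i))

theorem continuous_euclNorm {n : ℕ} : Continuous (euclNorm (n := n)) := by
  unfold euclNorm
  fun_prop

/-- The maximum of `f - σ` on the segment joining `l` to `μ`. -/
noncomputable def segMax {n : ℕ} (f : (Fin n → ℝ) → ℝ) (σ : ℝ) (μ l : Fin n → ℝ) : ℝ :=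
  sSup ((fun t : ℝ => f (t • μ + (1 - t) • l) - σ) '' Set.Icc 0 1)

/-- The part of the level set `{f = σ}` on the sphere of radius `R`. -/
def levelSphere {n : ℕ} (Γ : Set (Fin n → ℝ)) (f : (Fin n → ℝ) → ℝ) (σ R : ℝ) :
    Set (Fin n → ℝ) :=
  {l | euclNorm l = R ∧ l ∈ Γ ∧ f l = σ}

theorem Theta_eq {n : ℕ} (Γ : Set (Fin n → ℝ)) (f : (Fin n → ℝ) → ℝ) (σ : ℝ)
    (μ : Fin n → ℝ) (R : ℝ) :
    Theta Γ f σ μ R = sInf (segMax f σ μ '' levelSphere Γ f σ R) := rfl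

section Segment

variable {n : ℕ} {Γ : Set (Fin n → ℝ)} {f : (Fin n → ℝ) → ℝ} {σ : ℝ} {μ l : Fin n → ℝ}

theorem combo_mem (hconv : Convex ℝ Γ) (hμ : μ ∈ Γ) (hl : l ∈ Γ) {t : ℝ}
    (ht : t ∈ Icc (0 : ℝ) 1) : t • μ + (1 - t) • l ∈ Γ :=
  hconv hμ hl ht.1 (sub_nonneg.2 ht.2) (by ring)

theorem continuousOn_comp_combo (hconv : Convex ℝ Γ) (hcont : ContinuousOn f Γ) (hμ : μ ∈ Γ)
    (hl : l ∈ Γ) : ContinuousOn (fun t : ℝ => f (t • μ + (1 - t) • l) - σ) (Icc 0 1) :=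
  (hcont.comp (Continuous.continuousOn (by fun_prop))
    fun _ ht => combo_mem hconv hμ hl ht).sub continuousOn_const

theorem bddAbove_segment (hconv : Convex ℝ Γ) (hcont : ContinuousOn f Γ) (hμ : μ ∈ Γ)
    (hl : l ∈ Γ) : BddAbove ((fun t : ℝ => f (t • μ + (1 - t) • l) - σ) '' Icc 0 1) :=
  isCompact_Icc.bddAbove_image (continuousOn_comp_combo hconv hcont hμ hl)

theorem le_segMax (hconv : Convex ℝ Γ) (hcont : ContinuousOn f Γ) (hμ : μ ∈ Γ)
    (hl : l ∈ Γ) {t : ℝ} (ht : t ∈ Icc (0 : ℝ) 1) :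
    f (t • μ + (1 - t) • l) - σ ≤ segMax f σ μ l :=
  le_csSup (bddAbove_segment hconv hcont hμ hl) (mem_image_of_mem _ ht)

theorem exists_segMax_eq (hconv : Convex ℝ Γ) (hcont : ContinuousOn f Γ) (hμ : μ ∈ Γ)
    (hl : l ∈ Γ) : ∃ t ∈ Icc (0 : ℝ) 1, segMax f σ μ l = f (t • μ + (1 - t) • l) - σ :=
  isCompact_Icc.exists_sSup_image_eq (nonempty_Icc.2 zero_le_one)
    (continuousOn_comp_combo hconv hcont hμ hl)

theorem segMax_nonneg (hconv : Convex ℝ Γ) (hcont : ContinuousOn f Γ) (hμ : μ ∈ Γ)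
    (hl : l ∈ Γ) (hμσ : f μ = σ) : 0 ≤ segMax f σ μ l := by
  have h := le_segMax (σ := σ) hconv hcont hμ hl (right_mem_Icc.2 zero_le_one)
  simpa [hμσ] using h

theorem segMax_self (hμσ : f μ = σ) : segMax f σ μ μ = 0 := by
  have h (t : ℝ) : t • μ + (1 - t) • μ = μ := by rw [← add_smul]; simp
  simp [segMax, h, hμσ]

/-- If `f` touches its value `σ` inside the segment joining two points of `{f = σ}`, then it does
not exceed `σ` on it. -/
theorem segMax_nonpos_of_eq_interior (hcont : ContinuousOn f Γ) (hconc : ConcaveOn ℝ Γ f)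
    (hμ : μ ∈ Γ) (hl : l ∈ Γ) (hμσ : f μ = σ) (hlσ : f l = σ) {t : ℝ} (ht : t ∈ Ioo (0 : ℝ) 1)
    (hft : f (t • μ + (1 - t) • l) = σ) : segMax f σ μ l ≤ 0 := by
  obtain ⟨s, hs, hseq⟩ := exists_segMax_eq (σ := σ) hconc.1 hcont hμ hl
  rw [hseq]
  by_contra! hpos
  have hg : ConcaveOn ℝ (Icc (0 : ℝ) 1) (fun t : ℝ => f (AffineMap.lineMap l μ t)) :=
    (hconc.comp_affineMap (AffineMap.lineMap l μ)).subset
      (fun r hr => by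
        rw [mem_preimage, AffineMap.lineMap_apply_module, add_comm]
        exact combo_mem hconc.1 hμ hl hr) (convex_Icc 0 1)
  have heq (r : ℝ) : AffineMap.lineMap l μ r = r • μ + (1 - r) • l := by
    rw [AffineMap.lineMap_apply_module, add_comm]
  simp only [heq] at hg
  rcases lt_trichotomy s t with hst | rfl | hts
  · have h := hg.slope_anti_adjacent hs (right_mem_Icc.2 zero_le_one) hst ht.2
    simp only [hft, one_smul, sub_self, zero_smul, add_zero, hμσ, zero_div] at h
    exact h.not_gt (div_neg_of_neg_of_pos (by linarith) (by linarith))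
  · linarith
  · have h := hg.slope_anti_adjacent (left_mem_Icc.2 zero_le_one) hs ht.1 hts
    simp only [hft, zero_smul, sub_zero, one_smul, zero_add, hlσ, sub_self, zero_div] at h
    exact h.not_gt (div_pos hpos (by linarith))

/-- Moving the end point `t • μ + (1 - t) • l` of a segment down decreases its maximum. -/
theorem segMax_le_of_le (hconv : Convex ℝ Γ) (hcont : ContinuousOn f Γ) (hmono : StrictMonoOn f Γ)
    (hμ : μ ∈ Γ) (hl : l ∈ Γ) (hμσ : f μ = σ) {t : ℝ} (ht : t ∈ Icc (0 : ℝ) 1) {q : Fin n → ℝ}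
    (hq : q ∈ Γ) (hle : q ≤ t • μ + (1 - t) • l) :
    segMax f σ μ q ≤ segMax f σ μ l ∧
      (q < t • μ + (1 - t) • l → 0 < segMax f σ μ l → segMax f σ μ q < segMax f σ μ l) := by
  obtain ⟨s, hs, hseq⟩ := exists_segMax_eq (σ := σ) hconv hcont hμ hq
  have hcomb : s • μ + (1 - s) • (t • μ + (1 - t) • l) =
      (s + (1 - s) * t) • μ + (1 - (s + (1 - s) * t)) • l := by
    module
  have hmem : s + (1 - s) * t ∈ Icc (0 : ℝ) 1 := by
    obtain ⟨h0, h1⟩ := hs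
    obtain ⟨h2, h3⟩ := ht
    constructor <;> nlinarith
  have hbound := le_segMax (σ := σ) hconv hcont hμ hl hmem
  have hΓ := combo_mem hconv hμ hl hmem
  rw [← hcomb] at hbound hΓ
  have hsq := combo_mem hconv hμ hq hs
  refine ⟨?_, fun hlt hpos => ?_⟩
  · have := hmono.monotoneOn hsq hΓ
      (add_le_add_right (smul_le_smul_of_nonneg_left hle (sub_nonneg.2 hs.2)) (s • μ))
    linarith
  · rcases hs.2.eq_or_lt with rfl | hs1
    · simp only [one_smul, sub_self, zero_smul, add_zero, hμσ] at hseq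
      linarith
    · have := hmono hsq hΓ
        (add_lt_add_right (smul_lt_smul_of_pos_left hlt (sub_pos.2 hs1)) (s • μ))
      linarith

theorem lowerSemicontinuousOn_segMax (hconv : Convex ℝ Γ) (hcont : ContinuousOn f Γ) (hμ : μ ∈ Γ) :
    LowerSemicontinuousOn (segMax f σ μ) Γ := by
  have heq : segMax f σ μ =
      fun l => ⨆ t : Icc (0 : ℝ) 1, (f ((t : ℝ) • μ + (1 - (t : ℝ)) • l) - σ) := by
    ext l
    exact sSup_image'
  rw [heq]
  refine lowerSemicontinuousOn_ciSup (fun l hl => ?_) fun t => ContinuousOn.lowerSemicontinuousOn ?_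
  · have h := bddAbove_segment (σ := σ) hconv hcont hμ hl
    rwa [image_eq_range] at h
  · exact (hcont.comp (Continuous.continuousOn (by fun_prop))
      fun l hl => combo_mem hconv hμ hl t.2).sub continuousOn_const

end Segment

theorem isCompact_levelSphere {n : ℕ} {Γ : Set (Fin n → ℝ)} {f : (Fin n → ℝ) → ℝ} {σ : ℝ}
    (hcont : ContinuousOn f Γ) (hclosed : IsClosed {x | x ∈ Γ ∧ σ ≤ f x}) (R : ℝ) :
    IsCompact (levelSphere Γ f σ R) := by
  refine Metric.isCompact_of_isClosed_isBounded ?_ ?_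
  · have h := ((hcont.mono fun x hx => hx.1).preimage_isClosed_of_isClosed hclosed
      (isClosed_singleton (x := σ))).inter (isClosed_singleton.preimage continuous_euclNorm :
        IsClosed (euclNorm (n := n) ⁻¹' {R}))
    have heq : levelSphere Γ f σ R =
        {x | x ∈ Γ ∧ σ ≤ f x} ∩ f ⁻¹' {σ} ∩ euclNorm ⁻¹' {R} := by
      ext x
      exact ⟨fun ⟨hR, hx, hxσ⟩ => ⟨⟨⟨hx, hxσ.ge⟩, hxσ⟩, hR⟩,
        fun ⟨⟨⟨hx, _⟩, hxσ⟩, hR⟩ => ⟨hR, hx, hxσ⟩⟩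
    rwa [heq]
  · refine (Metric.isBounded_closedBall (x := (0 : Fin n → ℝ)) (r := R)).subset fun x hx => ?_
    have hR : 0 ≤ R := hx.1 ▸ Real.sqrt_nonneg _
    rw [mem_closedBall_zero_iff, pi_norm_le_iff_of_nonneg hR]
    exact fun i => (abs_apply_le_euclNorm x i).trans_eq hx.1

/-- Lemma 2.1: `Θ_R(μ)` is nondecreasing in `R`, and strictly increasing beyond any
`R₀ ≥ |μ|` with `Θ_{R₀}(μ) > 0`. -/
theorem theta_monotone
    (n : ℕ) (hn : 2 ≤ n) (Γ : Set (Fin n → ℝ))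
    (hΓopen : IsOpen Γ) (hΓconv : Convex ℝ Γ)
    (hΓcone : ∀ t : ℝ, 0 < t → ∀ x ∈ Γ, t • x ∈ Γ)
    (hΓsymm : ∀ π : Equiv.Perm (Fin n), ∀ x ∈ Γ, x ∘ π ∈ Γ)
    (hΓpos : {x : Fin n → ℝ | ∀ i, 0 < x i} ⊆ Γ)
    (hΓproper : Γ ≠ Set.univ) (hΓbd : (frontier Γ).Nonempty)
    (f : (Fin n → ℝ) → ℝ)
    (hf1 : ContDiffOn ℝ 1 f Γ)
    (hfsymm : ∀ π : Equiv.Perm (Fin n), ∀ x ∈ Γ, f (x ∘ π) = f x)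
    (hfpos : ∀ x ∈ Γ, ∀ i, 0 < pd f x i)
    (hfconc : ConcaveOn ℝ Γ f)
    (σ : ℝ)
    (hσ : ∀ μ₀ ∈ frontier Γ, Filter.limsup f (nhdsWithin μ₀ Γ) < σ)
    (hΓσne : {x | x ∈ Γ ∧ σ < f x}.Nonempty)
    (μ : Fin n → ℝ) (hμΓ : μ ∈ Γ) (hμσ : f μ = σ) :
    (∀ R R' : ℝ, euclNorm μ < R → R ≤ R' → Theta Γ f σ μ R ≤ Theta Γ f σ μ R') ∧
    (∀ R₀ : ℝ, euclNorm μ ≤ R₀ → 0 < Theta Γ f σ μ R₀ →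
      ∀ R R' : ℝ, R₀ ≤ R → R < R' → Theta Γ f σ μ R < Theta Γ f σ μ R') := by
  have : Nonempty (Fin n) := ⟨⟨0, by omega⟩⟩
  have hup := isUpperSet_of_convex_cone hΓopen hΓconv hΓcone hΓpos
  have hcont := hf1.continuousOn
  have hmono : StrictMonoOn f Γ := strictMonoOn_of_fderiv_single_pos hΓconv
    (fun x hx => (hf1.differentiableOn one_ne_zero).differentiableAt (hΓopen.mem_nhds hx)) hfpos
  have hclosed := isClosed_superlevel hup hΓopen hcont hmono.monotoneOn hσ
  obtain ⟨h, hh, hproj, hnonneg, hzero⟩ := exists_continuous_height_above_level hup hΓopen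
    hΓproper hcont hmono hσ ⟨μ, hμΓ, hμσ⟩
  have hnorm : Continuous fun x => euclNorm (x - fun _ => h x) :=
    continuous_euclNorm.comp (by fun_prop)
  have hfix : ∀ x ∈ Γ, f x = σ → x - (fun _ => h x) = x := fun x hx hxσ => by
    rw [hzero x hx hxσ]
    exact sub_zero x
  have hnonempty : ∀ R, euclNorm μ < R → (levelSphere Γ f σ R).Nonempty := by
    intro R hR
    let i : Fin n := ⟨0, by omega⟩
    let j : Fin n := ⟨1, by omega⟩
    have hij : j ≠ i := by simp [i, j]
    have hpath : Continuous fun k : ℝ =>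
        euclNorm ((μ + Pi.single i k) - fun _ => h (μ + Pi.single i k)) :=
      hnorm.comp (continuous_const.add (continuous_single (A := fun _ => ℝ) i))
    have hsurj := intermediate_value_univ 0 (2 * R + |μ i - μ j|) hpath
    obtain ⟨k, hk⟩ := @hsurj R (by
      refine ⟨by simpa [hfix μ hμΓ hμσ] using hR.le, ?_⟩
      generalize h _ = c
      set k := 2 * R + |μ i - μ j| with hk
      have h1 := (le_abs_self _).trans
        (abs_apply_le_euclNorm ((μ + Pi.single i k) - fun _ => c) i)
      have h2 := (neg_le_abs _).trans
        (abs_apply_le_euclNorm ((μ + Pi.single i k) - fun _ => c) j)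
      simp only [Pi.sub_apply, Pi.add_apply, Pi.single_eq_same, Pi.single_eq_of_ne hij] at h1 h2
      linarith [neg_abs_le (μ i - μ j)])
    exact ⟨_, hk, hproj _⟩
  have hshrink : ∀ R R' : ℝ, euclNorm μ < R → R ≤ R' → ∀ l ∈ levelSphere Γ f σ R',
      ∃ q ∈ levelSphere Γ f σ R, segMax f σ μ q ≤ segMax f σ μ l ∧
        (R < R' → 0 < segMax f σ μ l → segMax f σ μ q < segMax f σ μ l) := by
    rintro R R' hR hRR' l ⟨hlR, hl, hlσ⟩
    have hpath : Continuous fun t : ℝ =>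
        euclNorm ((t • μ + (1 - t) • l) - fun _ => h (t • μ + (1 - t) • l)) :=
      hnorm.comp (by fun_prop)
    obtain ⟨t, ht, htR⟩ := intermediate_value_Icc' zero_le_one hpath.continuousOn
      (show R ∈ _ by simpa [hfix μ hμΓ hμσ, hfix l hl hlσ, hlR] using ⟨hR.le, hRR'⟩)
    have hp := combo_mem hΓconv hμΓ hl ht
    have hpσ : σ ≤ f (t • μ + (1 - t) • l) := by
      simpa using (hfconc.convex_ge σ) ⟨hμΓ, hμσ.ge⟩ ⟨hl, hlσ.ge⟩ ht.1 (sub_nonneg.2 ht.2)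
        (by ring) |>.2
    have hp0 := hnonneg _ hp hpσ
    obtain ⟨hle, hlt⟩ := segMax_le_of_le (σ := σ) hΓconv hcont hmono hμΓ hl hμσ ht (hproj _).1
      (sub_le_self _ fun _ => hp0)
    refine ⟨_, ⟨htR, hproj _⟩, hle, fun hRlt hpos => hlt ?_ hpos⟩
    rcases hp0.eq_or_lt with h0 | h0
    · exfalso
      have hfp := (hproj (t • μ + (1 - t) • l)).2
      have hq : (t • μ + (1 - t) • l) - (fun _ => h (t • μ + (1 - t) • l)) =
          t • μ + (1 - t) • l := by
        rw [← h0]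
        exact sub_zero _
      simp only [hq] at hfp htR
      have ht0 : t ≠ 0 := by
        rintro rfl
        simp only [zero_smul, sub_zero, one_smul, zero_add] at htR
        linarith
      have ht1 : t ≠ 1 := by
        rintro rfl
        simp only [one_smul, sub_self, zero_smul, add_zero] at htR
        linarith
      exact hpos.not_ge (segMax_nonpos_of_eq_interior hcont hfconc hμΓ hl hμσ hlσ
        ⟨ht.1.lt_of_ne' ht0, ht.2.lt_of_ne ht1⟩ hfp)
    · exact sub_lt_self _ (Pi.lt_def.2 ⟨fun _ => hp0, Classical.arbitrary _, h0⟩)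
  have hle : ∀ R, ∀ l ∈ levelSphere Γ f σ R, Theta Γ f σ μ R ≤ segMax f σ μ l :=
    fun R l hl => csInf_le
      ⟨0, forall_mem_image.2 fun q hq => segMax_nonneg hΓconv hcont hμΓ hq.2.1 hμσ⟩
      (mem_image_of_mem (segMax f σ μ) hl)
  have hweak : ∀ R R' : ℝ, euclNorm μ < R → R ≤ R' → Theta Γ f σ μ R ≤ Theta Γ f σ μ R' := by
    intro R R' hR hRR'
    refine le_csInf ((hnonempty R' (hR.trans_le hRR')).image _) (forall_mem_image.2 fun l hl => ?_)
    obtain ⟨q, hq, hql, -⟩ := hshrink R R' hR hRR' l hl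
    exact (hle R q hq).trans hql
  refine ⟨hweak, fun R₀ hR₀ hpos R R' hR hRR' => ?_⟩
  have hμR₀ : euclNorm μ < R₀ := by
    refine hR₀.lt_of_ne fun heq => ?_
    have := hle R₀ μ ⟨heq, hμΓ, hμσ⟩
    rw [segMax_self hμσ] at this
    linarith
  have hμR := hμR₀.trans_le hR
  obtain ⟨l, hl, hmin⟩ := ((lowerSemicontinuousOn_segMax (σ := σ) hΓconv hcont hμΓ).mono
    fun x hx => hx.2.1).exists_isMinOn (hnonempty R' (hμR.trans hRR'))
    (isCompact_levelSphere hcont hclosed R')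
  have hΘ : Theta Γ f σ μ R' = segMax f σ μ l :=
    le_antisymm (hle R' l hl) (le_csInf ((hnonempty R' (hμR.trans hRR')).image _)
      (forall_mem_image.2 fun q hq => hmin hq))
  have hposl : 0 < segMax f σ μ l :=
    hΘ ▸ hpos.trans_le (hweak R₀ R' hμR₀ (hR.trans hRR'.le))
  obtain ⟨q, hq, -, hlt⟩ := hshrink R R' hμR hRR'.le l hl
  rw [hΘ]
  exact (hle R q hq).trans_lt (hlt hRR' hposl)
end

section
/- Let A and G be real symmetric n×n matrices that admit a common orthonormal eigenbasis v₁, …, v_n with A vᵢ = λᵢ vᵢ and G vᵢ = fᵢ vᵢ, where fᵢ > 0 for every i. Then there exist a constant c₀ > 0 depending only on n and an index r ∈ {1, …, n} such that Σ_{l=1}^{n−1} (A G A)_{ll} ≥ c₀ Σ_{i ≠ r} fᵢ λᵢ². (In the notation of the paper, with G = {F^{ij}(A)} the derivative matrix of F(A) = f(λ[A]), this reads Σ_{l<n} F^{ij} A_{il} A_{lj} ≥ c₀ Σ_{i ≠ r} fᵢ λᵢ².) -/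
open Finset

section OrthonormalEigenbasis

variable {ι : Type*} [Fintype ι] [DecidableEq ι]

theorem matrix_eq_transpose_mul_diagonal_mul {V M : Matrix ι ι ℝ} {d : ι → ℝ}
    (hV : V * V.transpose = 1) (hM : ∀ i, M.mulVec (V i) = d i • V i) :
    M = V.transpose * Matrix.diagonal d * V := by
  have key : M * V.transpose = V.transpose * Matrix.diagonal d := by
    ext a i
    rw [Matrix.mul_diagonal]
    simpa [mul_comm, Matrix.mul_apply, Matrix.mulVec, dotProduct] using congrFun (hM i) a
  rw [← key, Matrix.mul_assoc, mul_eq_one_comm.mp hV, Matrix.mul_one]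

theorem mul_mul_diag_eq_sum {V A G : Matrix ι ι ℝ} {lam fv : ι → ℝ}
    (hV : V * V.transpose = 1) (hA : ∀ i, A.mulVec (V i) = lam i • V i)
    (hG : ∀ i, G.mulVec (V i) = fv i • V i) (l : ι) :
    (A * G * A) l l = ∑ i, fv i * lam i ^ 2 * V i l ^ 2 := by
  have hAGA : A * G * A = V.transpose * Matrix.diagonal (fun i => fv i * lam i ^ 2) * V := by
    refine matrix_eq_transpose_mul_diagonal_mul hV fun i => ?_
    rw [← Matrix.mulVec_mulVec, ← Matrix.mulVec_mulVec, hA, Matrix.mulVec_smul, hG,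
      Matrix.mulVec_smul, Matrix.mulVec_smul, hA, smul_smul, smul_smul]
    congr 1
    ring
  rw [hAGA, Matrix.mul_apply]
  refine sum_congr rfl fun i _ => ?_
  rw [Matrix.mul_diagonal, Matrix.transpose_apply]
  ring

theorem exists_forall_ne_sq_le_half [Nonempty ι] {w : ι → ℝ} (hw : ∑ i, w i ^ 2 = 1) :
    ∃ r, ∀ i ≠ r, w i ^ 2 ≤ 1 / 2 := by
  obtain ⟨r, hr⟩ := Finite.exists_max fun i => w i ^ 2
  refine ⟨r, fun i hi => ?_⟩
  have hpair : w i ^ 2 + w r ^ 2 ≤ 1 := by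
    rw [← hw, ← sum_pair (f := fun j => w j ^ 2) hi]
    exact sum_le_sum_of_subset_of_nonneg (subset_univ _) fun j _ _ => sq_nonneg _
  linarith [hr i]

theorem exists_half_sum_erase_le {V A G : Matrix ι ι ℝ} {lam fv : ι → ℝ}
    (hV : V * V.transpose = 1) (hA : ∀ i, A.mulVec (V i) = lam i • V i)
    (hG : ∀ i, G.mulVec (V i) = fv i • V i) (hf : ∀ i, 0 ≤ fv i) (m : ι) :
    ∃ r, 1 / 2 * ∑ i ∈ univ.erase r, fv i * lam i ^ 2 ≤
      ∑ l ∈ univ.erase m, (A * G * A) l l := by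
  have hrow (i : ι) : ∑ l, V i l ^ 2 = 1 := by
    simpa [Matrix.mul_apply, sq] using congrFun (congrFun hV i) i
  have hV' : V.transpose * V = 1 := mul_eq_one_comm.mp hV
  have hcol : ∑ i, V i m ^ 2 = 1 := by
    simpa [Matrix.mul_apply, sq] using congrFun (congrFun hV' m) m
  have htrunc (i : ι) : ∑ l ∈ univ.erase m, V i l ^ 2 = 1 - V i m ^ 2 := by
    rw [← hrow i, ← add_sum_erase univ (fun l => V i l ^ 2) (mem_univ m)]
    ring
  have : Nonempty ι := ⟨m⟩
  obtain ⟨r, hr⟩ := exists_forall_ne_sq_le_half hcol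
  refine ⟨r, ?_⟩
  calc
    1 / 2 * ∑ i ∈ univ.erase r, fv i * lam i ^ 2
        ≤ ∑ i ∈ univ.erase r, fv i * lam i ^ 2 * ∑ l ∈ univ.erase m, V i l ^ 2 := by
      rw [mul_sum]
      refine sum_le_sum fun i hi => ?_
      rw [htrunc, mul_comm]
      exact mul_le_mul_of_nonneg_left (by linarith [hr i (ne_of_mem_erase hi)])
        (mul_nonneg (hf i) (sq_nonneg _))
    _ ≤ ∑ i, fv i * lam i ^ 2 * ∑ l ∈ univ.erase m, V i l ^ 2 :=
      sum_le_sum_of_subset_of_nonneg (subset_univ _) fun i _ _ =>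
        mul_nonneg (mul_nonneg (hf i) (sq_nonneg _)) (sum_nonneg fun l _ => sq_nonneg _)
    _ = ∑ l ∈ univ.erase m, (A * G * A) l l := by
      simp_rw [mul_mul_diag_eq_sum hV hA hG, mul_sum]
      exact sum_comm

end OrthonormalEigenbasis

/-- Proposition 2.6: if symmetric matrices `A` and `G` (the latter positive definite) are
simultaneously diagonalized by an orthonormal basis `v` with `A vᵢ = λᵢ vᵢ`, `G vᵢ = fᵢ vᵢ`,
`fᵢ > 0`, then there are `c₀ > 0` depending only on `n` and an index `r` such that
`Σ_{l<n} (A G A)_{ll} ≥ c₀ Σ_{i ≠ r} fᵢ λᵢ²`. -/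
theorem sum_truncated_quadratic_lower_bound (n : ℕ) (hn : 2 ≤ n) :
    ∃ c₀ : ℝ, 0 < c₀ ∧
      ∀ (A G : Matrix (Fin n) (Fin n) ℝ) (lam fv : Fin n → ℝ) (v : Fin n → Fin n → ℝ),
        A.IsSymm → G.IsSymm →
        (∀ i j : Fin n, (∑ k, v i k * v j k) = if i = j then (1 : ℝ) else 0) →
        (∀ i, A.mulVec (v i) = lam i • v i) →
        (∀ i, G.mulVec (v i) = fv i • v i) →
        (∀ i, 0 < fv i) →
        ∃ r : Fin n,
          c₀ * ∑ i ∈ Finset.univ.erase r, fv i * lam i ^ 2 ≤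
            ∑ l ∈ Finset.univ.filter (fun l : Fin n => (l : ℕ) + 1 < n), (A * G * A) l l := by
  refine ⟨1 / 2, by norm_num, fun A G lam fv v _ _ hv hA hG hf => ?_⟩
  have hV : Matrix.of v * (Matrix.of v).transpose = 1 := by
    ext i j
    simp [Matrix.mul_apply, hv, Matrix.one_apply]
  have hlast : univ.filter (fun l : Fin n => (l : ℕ) + 1 < n) =
      univ.erase (⟨n - 1, by omega⟩ : Fin n) := by
    ext l
    simp only [mem_filter, mem_univ, true_and, mem_erase, and_true, ne_eq, Fin.ext_iff]
    omega
  rw [hlast]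
  exact exists_half_sum_erase_le hV hA hG (fun i => (hf i).le) _
end

section
/- Suppose in addition that Σᵢ fᵢ(λ) λᵢ ≥ 0 for all λ ∈ Γ. Then for every λ ∈ Γ and every index r with λ_r < 0 one has Σ_{i ≠ r} fᵢ(λ) λᵢ² ≥ (1/n) Σᵢ fᵢ(λ) λᵢ². -/
open Filter Set

/-- A concave function lies below its tangent planes. -/
theorem ConcaveOn.sub_le_fderiv {E : Type*} [NormedAddCommGroup E] [NormedSpace ℝ E]
    {s : Set E} {f : E → ℝ} (hf : ConcaveOn ℝ s f) {x y : E} (hx : x ∈ s) (hy : y ∈ s)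
    (hd : DifferentiableAt ℝ f x) : f y - f x ≤ fderiv ℝ f x (y - x) := by
  have hg := hf.comp_affineMap (AffineMap.lineMap x y : ℝ →ᵃ[ℝ] E)
  have hderiv : HasDerivAt (f ∘ (AffineMap.lineMap x y : ℝ →ᵃ[ℝ] E))
      (fderiv ℝ f x (y - x)) 0 := by
    refine HasFDerivAt.comp_hasDerivAt (0 : ℝ) ?_ AffineMap.hasDerivAt_lineMap
    simpa using hd.hasFDerivAt
  have h := hg.slope_le_of_hasDerivAt (x := 0) (y := 1) (by simpa using hx)
    (by simpa using hy) one_pos hderiv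
  simpa [slope_def_field] using h

/-- For a symmetric concave function, the partial derivative at a larger coordinate is smaller. -/
theorem pd_le_pd_of_lt {n : ℕ} {Γ : Set (Fin n → ℝ)} {f : (Fin n → ℝ) → ℝ}
    (hΓsymm : ∀ π : Equiv.Perm (Fin n), ∀ x ∈ Γ, x ∘ π ∈ Γ)
    (hfsymm : ∀ π : Equiv.Perm (Fin n), ∀ x ∈ Γ, f (x ∘ π) = f x)
    (hfconc : ConcaveOn ℝ Γ f) {x : Fin n → ℝ} (hx : x ∈ Γ) (hd : DifferentiableAt ℝ f x)
    {i r : Fin n} (hlt : x r < x i) : pd f x i ≤ pd f x r := by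
  have hne : i ≠ r := fun h => by simp [h] at hlt
  have h := hfconc.sub_le_fderiv hx (hΓsymm (Equiv.swap i r) x hx) hd
  have hsub : x ∘ Equiv.swap i r - x =
      (x i - x r) • (Pi.single r (1 : ℝ) - Pi.single i (1 : ℝ) : Fin n → ℝ) := by
    ext j
    by_cases hi : j = i
    · subst hi
      simp [hne]
    · by_cases hr : j = r
      · subst hr
        simp [hi]
      · simp [Equiv.swap_apply_of_ne_of_ne hi hr, hi, hr]
  rw [hfsymm _ x hx, hsub, map_smul, map_sub, sub_self, smul_eq_mul] at h
  exact sub_nonneg.1 (nonneg_of_mul_nonneg_right h (sub_pos.2 hlt))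

/-- The weighted quadratic inequality behind `erase_sum_quadratic_lower_bound`. -/
theorem mul_sq_le_card_mul_sum_erase {ι : Type*} [Fintype ι] [DecidableEq ι] {a x : ι → ℝ} {r : ι}
    (ha : ∀ i, 0 < a i) (hle : ∀ i, x r < x i → a i ≤ a r)
    (hsum : 0 ≤ ∑ i, a i * x i) (hr : x r < 0) :
    a r * x r ^ 2 ≤
      ((Fintype.card ι : ℝ) - 1) * ∑ i ∈ Finset.univ.erase r, a i * x i ^ 2 := by
  have hcard : ((Finset.univ.erase r).card : ℝ) = (Fintype.card ι : ℝ) - 1 := by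
    have := Finset.card_erase_add_one (Finset.mem_univ r)
    rw [Finset.card_univ] at this
    rw [← this]
    simp
  have hbound : a r * -x r ≤ ∑ i ∈ Finset.univ.erase r, a i * max (x i) 0 := by
    rw [← Finset.add_sum_erase _ _ (Finset.mem_univ r)] at hsum
    have : ∑ i ∈ Finset.univ.erase r, a i * x i ≤
        ∑ i ∈ Finset.univ.erase r, a i * max (x i) 0 :=
      Finset.sum_le_sum fun i _ => mul_le_mul_of_nonneg_left (le_max_left _ _) (ha i).le
    linarith
  have hterm : ∀ i, (a i * max (x i) 0) ^ 2 ≤ a r * (a i * x i ^ 2) := by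
    intro i
    rcases le_or_gt (x i) 0 with hi | hi
    · rw [max_eq_right hi]
      have := ha r
      have := ha i
      simp only [mul_zero, ne_eq, OfNat.ofNat_ne_zero, not_false_eq_true, zero_pow]
      positivity
    · rw [max_eq_left hi.le]
      have := mul_le_mul_of_nonneg_right (hle i (hr.trans hi))
        (mul_nonneg (ha i).le (sq_nonneg (x i)))
      linarith
  have hnonneg : 0 ≤ a r * -x r := mul_nonneg (ha r).le (by linarith)
  have hsq : (a r * -x r) ^ 2 ≤ ((Fintype.card ι : ℝ) - 1) *
      (a r * ∑ i ∈ Finset.univ.erase r, a i * x i ^ 2) := by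
    calc (a r * -x r) ^ 2
        ≤ (∑ i ∈ Finset.univ.erase r, a i * max (x i) 0) ^ 2 := by gcongr
      _ ≤ (Finset.univ.erase r).card * ∑ i ∈ Finset.univ.erase r, (a i * max (x i) 0) ^ 2 :=
          sq_sum_le_card_mul_sum_sq
      _ ≤ (Finset.univ.erase r).card * ∑ i ∈ Finset.univ.erase r, a r * (a i * x i ^ 2) := by
          gcongr with i
          exact hterm i
      _ = _ := by rw [hcard, ← Finset.mul_sum]
  refine le_of_mul_le_mul_left ?_ (ha r)
  linarith

/-- Lemma 2.7: if `Σ_i f_i(λ) λ_i ≥ 0` on `Γ`, then for `λ ∈ Γ` and any index `r` with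
`λ_r < 0`, `Σ_{i ≠ r} f_i λ_i² ≥ (1/n) Σ_i f_i λ_i²`. -/
theorem erase_sum_quadratic_lower_bound
    (n : ℕ) (hn : 2 ≤ n) (Γ : Set (Fin n → ℝ))
    (hΓopen : IsOpen Γ) (hΓconv : Convex ℝ Γ)
    (hΓcone : ∀ t : ℝ, 0 < t → ∀ x ∈ Γ, t • x ∈ Γ)
    (hΓsymm : ∀ π : Equiv.Perm (Fin n), ∀ x ∈ Γ, x ∘ π ∈ Γ)
    (hΓpos : {x : Fin n → ℝ | ∀ i, 0 < x i} ⊆ Γ)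
    (hΓproper : Γ ≠ Set.univ) (hΓbd : (frontier Γ).Nonempty)
    (f : (Fin n → ℝ) → ℝ)
    (hf1 : ContDiffOn ℝ 1 f Γ)
    (hfsymm : ∀ π : Equiv.Perm (Fin n), ∀ x ∈ Γ, f (x ∘ π) = f x)
    (hfpos : ∀ x ∈ Γ, ∀ i, 0 < pd f x i)
    (hfconc : ConcaveOn ℝ Γ f)
    (hsum : ∀ x ∈ Γ, 0 ≤ ∑ i, pd f x i * x i) :
    ∀ x ∈ Γ, ∀ r : Fin n, x r < 0 →
      (1 / (n : ℝ)) * ∑ i, pd f x i * x i ^ 2 ≤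
        ∑ i ∈ Finset.univ.erase r, pd f x i * x i ^ 2 := by
  intro x hx r hr
  have hd : DifferentiableAt ℝ f x :=
    (hf1.contDiffAt (hΓopen.mem_nhds hx)).differentiableAt one_ne_zero
  have key := mul_sq_le_card_mul_sum_erase (hfpos x hx)
    (fun i hi => pd_le_pd_of_lt hΓsymm hfsymm hfconc hx hd hi) (hsum x hx) hr
  rw [Fintype.card_fin] at key
  have hn0 : (0 : ℝ) < n := by exact_mod_cast (by omega : 0 < n)
  rw [one_div, inv_mul_le_iff₀ hn0, ← Finset.add_sum_erase _ _ (Finset.mem_univ r)]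
  linarith
end

section
/- Suppose in addition that (iii) L₀ := liminf_{λ → 0, λ ∈ Γ} f(λ) > −∞, and (iv) for every σ > sup_{∂Γ} f, Σᵢ fᵢ(λ) → +∞ as |λ| → +∞ with λ ∈ ∂Γ^σ. Then Γₙ⁺ ⊆ 𝒞_σ⁺ for every σ > sup_{∂Γ} f with Γ^σ ≠ ∅. -/
open Filter Set

/-- The tangent cone at infinity `𝒞_σ` to the level hypersurface `∂Γ^σ = {λ ∈ Γ : f λ = σ}`. -/
def Ctan {n : ℕ} (Γ : Set (Fin n → ℝ)) (f : (Fin n → ℝ) → ℝ) (σ : ℝ) : Set (Fin n → ℝ) :=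
  {μ | ∃ (lam : ℕ → Fin n → ℝ) (t : ℕ → ℝ),
    (∀ k, lam k ∈ Γ ∧ f (lam k) = σ) ∧ (∀ k, 0 < t k) ∧
    Filter.Tendsto t Filter.atTop (nhds 0) ∧
    Filter.Tendsto (fun k => t k • lam k) Filter.atTop (nhds μ)}

/-- `𝒞_σ⁺`: the connected component of `Γ \ 𝒞_σ` containing `Γ^σ = {λ ∈ Γ : f λ > σ}`. -/
def Cplus {n : ℕ} (Γ : Set (Fin n → ℝ)) (f : (Fin n → ℝ) → ℝ) (σ : ℝ) : Set (Fin n → ℝ) :=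
  ⋃ y ∈ {x | x ∈ Γ ∧ σ < f x}, connectedComponentIn (Γ \ Ctan Γ f σ) y

/-- A concave function lies below its tangent plane at a point of differentiability. -/
theorem ConcaveOn.le_add_fderiv {E : Type*} [NormedAddCommGroup E] [NormedSpace ℝ E]
    {s : Set E} {f : E → ℝ} (hf : ConcaveOn ℝ s f) {x y : E} (hx : x ∈ s) (hy : y ∈ s)
    (hd : DifferentiableAt ℝ f x) : f y ≤ f x + fderiv ℝ f x (y - x) := by
  have hline : HasDerivAt (fun t : ℝ => f (x + t • (y - x))) (fderiv ℝ f x (y - x)) 0 :=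
    hd.hasFDerivAt.hasLineDerivAt (y - x)
  have hlim := hline.tendsto_slope_zero_right
  have key : f y - f x ≤ fderiv ℝ f x (y - x) := by
    refine ge_of_tendsto hlim ?_
    filter_upwards [Ioc_mem_nhdsGT (zero_lt_one' ℝ)] with t ht
    have hc := hf.2 hx hy (sub_nonneg.2 ht.2) ht.1.le (by ring)
    have hcomb : (1 - t) • x + t • y = x + t • (y - x) := by module
    rw [hcomb] at hc
    simp only [zero_add, zero_smul, add_zero, smul_eq_mul] at hc ⊢
    rw [inv_mul_eq_div, le_div_iff₀ ht.1]
    linarith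
  linarith

/-- The derivative in direction `v` is the sum of the partial derivatives weighted by `v`. -/
theorem fderiv_eq_sum_pd {n : ℕ} (f : (Fin n → ℝ) → ℝ) (x v : Fin n → ℝ) :
    fderiv ℝ f x v = ∑ i, v i * pd f x i := by
  conv_lhs => rw [pi_eq_sum_univ' v]
  simp [pd, Pi.single]

/-- If `f` is bounded below near the vertex of the cone, then its radial derivative
at `x` is controlled by `f x`. -/
theorem fderiv_self_le_of_eventually_le {E : Type*} [NormedAddCommGroup E] [NormedSpace ℝ E]
    {s : Set E} {f : E → ℝ} {L : ℝ} (hf : ConcaveOn ℝ s f)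
    (hcone : ∀ t : ℝ, 0 < t → ∀ x ∈ s, t • x ∈ s)
    (hL : ∀ᶠ x in nhdsWithin (0 : E) s, L ≤ f x) {x : E} (hx : x ∈ s)
    (hd : DifferentiableAt ℝ f x) : fderiv ℝ f x x ≤ f x - L := by
  have hto : Tendsto (fun t : ℝ => t • x) (nhdsWithin 0 (Ioi 0)) (nhdsWithin 0 s) := by
    refine tendsto_nhdsWithin_iff.2 ⟨?_, ?_⟩
    · have : Tendsto (fun t : ℝ => t • x) (nhds 0) (nhds ((0 : ℝ) • x)) :=
        (continuous_id.smul continuous_const).tendsto 0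
      rw [zero_smul] at this
      exact this.mono_left nhdsWithin_le_nhds
    · filter_upwards [self_mem_nhdsWithin] with t ht
      exact hcone t ht x hx
  have hlim : Tendsto (fun t : ℝ => (1 - t) * fderiv ℝ f x x) (nhdsWithin 0 (Ioi 0))
      (nhds ((1 - 0) * fderiv ℝ f x x)) :=
    (((continuous_const.sub continuous_id).mul continuous_const).tendsto 0).mono_left
      nhdsWithin_le_nhds
  rw [sub_zero, one_mul] at hlim
  refine le_of_tendsto hlim ?_
  filter_upwards [hto.eventually hL, self_mem_nhdsWithin] with t ht htpos
  have h := hf.le_add_fderiv hx (hcone t htpos x hx) hd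
  have hcomb : t • x - x = (t - 1) • x := by module
  rw [hcomb, map_smul, smul_eq_mul] at h
  linarith

theorem le_euclNorm {n : ℕ} (x : Fin n → ℝ) (i : Fin n) : x i ≤ euclNorm x :=
  Real.le_sqrt_of_sq_le
    (Finset.single_le_sum (f := fun j => x j ^ 2) (fun j _ => sq_nonneg (x j)) (Finset.mem_univ i))

/-- A sequence whose rescalings by `t k → 0⁺` converge to a positive vector has all its
coordinates tending to infinity. -/
theorem eventually_forall_lt_of_tendsto_smul {n : ℕ} {lam : ℕ → Fin n → ℝ} {t : ℕ → ℝ}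
    {μ : Fin n → ℝ} (hμ : ∀ i, 0 < μ i) (htpos : ∀ k, 0 < t k)
    (ht : Tendsto t atTop (nhds 0)) (hlim : Tendsto (fun k => t k • lam k) atTop (nhds μ))
    (K : ℝ) : ∀ᶠ k in atTop, ∀ i, K < lam k i := by
  refine eventually_all.2 fun i => ?_
  have h1 : Tendsto (fun k => t k * lam k i) atTop (nhds (μ i)) :=
    (tendsto_pi_nhds.1 hlim) i
  have h2 : Tendsto (fun k => t k * K) atTop (nhds 0) := by
    simpa using ht.mul_const K
  filter_upwards [h2.eventually_lt h1 (hμ i)] with k hk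
  exact lt_of_mul_lt_mul_left hk (htpos k).le

/-- Lemma 5.1: if `f` is bounded below near the origin (`L₀ = liminf_{λ → 0} f(λ) > -∞`) and
`Σ_i f_i(λ) → +∞` as `|λ| → ∞` along `∂Γ^σ` for every `σ > sup_{∂Γ} f`, then
`Γₙ⁺ ⊆ 𝒞_σ⁺` for every such `σ` with `Γ^σ ≠ ∅`. -/
theorem positive_cone_subset_Cplus
    (n : ℕ) (hn : 2 ≤ n) (Γ : Set (Fin n → ℝ))
    (hΓopen : IsOpen Γ) (hΓconv : Convex ℝ Γ)
    (hΓcone : ∀ t : ℝ, 0 < t → ∀ x ∈ Γ, t • x ∈ Γ)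
    (hΓsymm : ∀ π : Equiv.Perm (Fin n), ∀ x ∈ Γ, x ∘ π ∈ Γ)
    (hΓpos : {x : Fin n → ℝ | ∀ i, 0 < x i} ⊆ Γ)
    (hΓproper : Γ ≠ Set.univ) (hΓbd : (frontier Γ).Nonempty)
    (f : (Fin n → ℝ) → ℝ)
    (hf1 : ContDiffOn ℝ 1 f Γ)
    (hfsymm : ∀ π : Equiv.Perm (Fin n), ∀ x ∈ Γ, f (x ∘ π) = f x)
    (hfpos : ∀ x ∈ Γ, ∀ i, 0 < pd f x i)
    (hfconc : ConcaveOn ℝ Γ f)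
    (L₀ : ℝ) (hL0 : ∀ᶠ x in nhdsWithin (0 : Fin n → ℝ) Γ, L₀ ≤ f x)
    (hdiv : ∀ σ : ℝ, (∀ μ₀ ∈ frontier Γ, Filter.limsup f (nhdsWithin μ₀ Γ) < σ) →
      ∀ M : ℝ, ∃ R : ℝ, ∀ l ∈ Γ, f l = σ → R ≤ euclNorm l → M ≤ ∑ i, pd f l i) :
    ∀ σ : ℝ, (∀ μ₀ ∈ frontier Γ, Filter.limsup f (nhdsWithin μ₀ Γ) < σ) →
      {x | x ∈ Γ ∧ σ < f x}.Nonempty →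
      {x : Fin n → ℝ | ∀ i, 0 < x i} ⊆ Cplus Γ f σ := by
  intro σ hσ hne
  have hdiff : ∀ x ∈ Γ, DifferentiableAt ℝ f x := fun x hx =>
    (hf1.differentiableOn one_ne_zero).differentiableAt (hΓopen.mem_nhds hx)
  have hdisj : ∀ μ : Fin n → ℝ, (∀ i, 0 < μ i) → μ ∉ Ctan Γ f σ := by
    rintro μ hμ ⟨lam, t, hlam, htpos, ht, hlim⟩
    obtain ⟨R, hR⟩ := hdiv σ hσ 1
    obtain ⟨k, hk⟩ := (eventually_forall_lt_of_tendsto_smul hμ htpos ht hlim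
      (max R (max 0 (σ - L₀)))).exists
    simp only [max_lt_iff] at hk
    obtain ⟨hkΓ, hkσ⟩ := hlam k
    have i₀ : Fin n := ⟨0, by omega⟩
    have hsum := hR _ hkΓ hkσ ((hk i₀).1.le.trans (le_euclNorm _ i₀))
    have hrad := fderiv_self_le_of_eventually_le hfconc hΓcone hL0 hkΓ (hdiff _ hkΓ)
    rw [fderiv_eq_sum_pd, hkσ] at hrad
    have hlt : max 0 (σ - L₀) * ∑ i, pd f (lam k) i < ∑ i, lam k i * pd f (lam k) i := by
      rw [Finset.mul_sum]
      exact Finset.sum_lt_sum_of_nonempty ⟨i₀, Finset.mem_univ i₀⟩ fun i _ =>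
        mul_lt_mul_of_pos_right (max_lt (hk i).2.1 (hk i).2.2) (hfpos _ hkΓ i)
    have hle := le_mul_of_one_le_right (le_max_left 0 (σ - L₀)) hsum
    linarith [le_max_right 0 (σ - L₀)]
  obtain ⟨z, hzΓ, hzσ⟩ := hne
  set w : Fin n → ℝ := fun i => |z i| + 1 with hw
  have hwpos : ∀ i, 0 < w i := fun i => by positivity
  have hzw : ∀ i, 0 < (z + w) i := fun i => by
    have := neg_abs_le (z i)
    simp only [hw, Pi.add_apply]
    linarith
  have hzwΓ : z + w ∈ Γ := hΓpos hzw
  have hzwσ : σ < f (z + w) := by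
    have h := hfconc.le_add_fderiv hzwΓ hzΓ (hdiff _ hzwΓ)
    have hcomb : z - (z + w) = -w := by abel
    rw [hcomb, map_neg, fderiv_eq_sum_pd] at h
    have hnn : 0 ≤ ∑ i, w i * pd f (z + w) i :=
      Finset.sum_nonneg fun i _ => (mul_pos (hwpos i) (hfpos _ hzwΓ i)).le
    linarith
  have hconv : Convex ℝ {x : Fin n → ℝ | ∀ i, 0 < x i} := by
    have : {x : Fin n → ℝ | ∀ i, 0 < x i} = Set.univ.pi fun _ => Ioi 0 := by
      ext x; simp
    rw [this]
    exact convex_pi fun _ _ => convex_Ioi 0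
  have hsub : {x : Fin n → ℝ | ∀ i, 0 < x i} ⊆ Γ \ Ctan Γ f σ :=
    fun y hy => ⟨hΓpos hy, hdisj y hy⟩
  intro x hx
  exact mem_iUnion₂.2 ⟨z + w, ⟨hzwΓ, hzwσ⟩,
    hconv.isPreconnected.subset_connectedComponentIn hzw hsub hx⟩
end

section
/- Suppose in addition that L₀ := liminf_{λ → 0, λ ∈ Γ} f(λ) > −∞. Then Σᵢ fᵢ(λ) λᵢ ≤ f(λ) − L₀ for every λ ∈ Γ. -/
open Filter Set

/-- The gradient inequality for a concave function along the ray through `x`. -/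
theorem ConcaveOn.one_sub_mul_fderiv_le {E : Type*} [NormedAddCommGroup E] [NormedSpace ℝ E]
    {s : Set E} {f : E → ℝ} (hf : ConcaveOn ℝ s f) {x : E} (hx : x ∈ s)
    (hd : DifferentiableAt ℝ f x) {t : ℝ} (ht : t < 1) (htx : t • x ∈ s) :
    (1 - t) * fderiv ℝ f x x ≤ f x - f (t • x) := by
  have hconc := hf.comp_linearMap (LinearMap.toSpanSingleton ℝ E x)
  have hderiv : HasDerivAt (f ∘ LinearMap.toSpanSingleton ℝ E x) (fderiv ℝ f x x) 1 := by
    have hline : HasDerivAt (fun r : ℝ => r • x) x 1 := by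
      simpa using (hasDerivAt_id (1 : ℝ)).smul_const x
    have hfx : HasFDerivAt f (fderiv ℝ f x) ((1 : ℝ) • x) := by
      simpa using hd.hasFDerivAt
    exact hfx.comp_hasDerivAt 1 hline
  have h := hconc.le_slope_of_hasDerivAt (x := t) (y := 1) (by simpa using htx)
    (by simpa using hx) ht hderiv
  rw [slope_def_field, le_div_iff₀ (sub_pos.mpr ht)] at h
  simpa [mul_comm] using h

theorem sum_pd_mul_eq_fderiv {n : ℕ} (f : (Fin n → ℝ) → ℝ) (x : Fin n → ℝ) :
    ∑ i, pd f x i * x i = fderiv ℝ f x x := by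
  conv_rhs => arg 2; rw [← Finset.univ_sum_single x]
  rw [map_sum]
  refine Finset.sum_congr rfl fun i _ => ?_
  rw [pd, mul_comm, ← smul_eq_mul, ← map_smul, ← Pi.single_smul, smul_eq_mul, mul_one]

/-- Inequality (5.6): if `L₀ = liminf_{λ → 0, λ ∈ Γ} f(λ) > -∞`, then
`Σ_i f_i(λ) λ_i ≤ f(λ) - L₀` for every `λ ∈ Γ`. -/
theorem sum_fi_lambda_le
    (n : ℕ) (hn : 2 ≤ n) (Γ : Set (Fin n → ℝ))
    (hΓopen : IsOpen Γ) (hΓconv : Convex ℝ Γ)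
    (hΓcone : ∀ t : ℝ, 0 < t → ∀ x ∈ Γ, t • x ∈ Γ)
    (hΓsymm : ∀ π : Equiv.Perm (Fin n), ∀ x ∈ Γ, x ∘ π ∈ Γ)
    (hΓpos : {x : Fin n → ℝ | ∀ i, 0 < x i} ⊆ Γ)
    (hΓproper : Γ ≠ Set.univ) (hΓbd : (frontier Γ).Nonempty)
    (f : (Fin n → ℝ) → ℝ)
    (hf1 : ContDiffOn ℝ 1 f Γ)
    (hfsymm : ∀ π : Equiv.Perm (Fin n), ∀ x ∈ Γ, f (x ∘ π) = f x)
    (hfpos : ∀ x ∈ Γ, ∀ i, 0 < pd f x i)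
    (hfconc : ConcaveOn ℝ Γ f)
    (L₀ : ℝ) (hL0 : ∀ᶠ x in nhdsWithin (0 : Fin n → ℝ) Γ, L₀ ≤ f x) :
    ∀ x ∈ Γ, ∑ i, pd f x i * x i ≤ f x - L₀ := by
  intro x hx
  rw [sum_pd_mul_eq_fderiv]
  have hd : DifferentiableAt ℝ f x :=
    (hf1.contDiffAt (hΓopen.mem_nhds hx)).differentiableAt (by simp)
  have hray : Tendsto (fun t : ℝ => t • x) (nhdsWithin 0 (Ioi 0)) (nhdsWithin 0 Γ) := by
    refine tendsto_nhdsWithin_iff.mpr ⟨?_, ?_⟩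
    · have h : Continuous fun t : ℝ => t • x := by fun_prop
      simpa using (h.tendsto 0).mono_left nhdsWithin_le_nhds
    · filter_upwards [self_mem_nhdsWithin] with t ht using hΓcone t ht x hx
  have hlim : Tendsto (fun t : ℝ => (1 - t) * fderiv ℝ f x x) (nhdsWithin 0 (Ioi 0))
      (nhds (fderiv ℝ f x x)) := by
    have h : Continuous fun t : ℝ => (1 - t) * fderiv ℝ f x x := by fun_prop
    simpa using (h.tendsto 0).mono_left nhdsWithin_le_nhds
  refine le_of_tendsto hlim ?_
  filter_upwards [hray.eventually hL0, Ioo_mem_nhdsGT (zero_lt_one' ℝ)] with t hL ht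
  have h := hfconc.one_sub_mul_fderiv_le hx hd ht.2 (hΓcone t ht.1 x hx)
  linarith
end

section
/- Fix σ > sup_{∂Γ} f with Γ^σ ≠ ∅ and suppose ∂Γ^σ ∩ 𝒞_σ = ∅. Then every λ ∈ Γ with f(λ) ≥ σ belongs to 𝒞_σ⁺. -/
open Filter Set

/-- The tangent cone at infinity is invariant under positive dilations. -/
theorem smul_mem_Ctan {n : ℕ} {Γ : Set (Fin n → ℝ)} {f : (Fin n → ℝ) → ℝ} {σ s : ℝ}
    {μ : Fin n → ℝ} (hs : 0 < s) (hμ : μ ∈ Ctan Γ f σ) : s • μ ∈ Ctan Γ f σ := by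
  obtain ⟨lam, t, hlam, ht, ht0, hlim⟩ := hμ
  refine ⟨lam, fun k => s * t k, hlam, fun k => mul_pos hs (ht k), ?_, ?_⟩
  · simpa using ht0.const_mul s
  · simpa [mul_smul] using hlim.const_smul s

/-- Along a ray, `s • l` tends to the vertex within the cone. -/
theorem tendsto_smul_nhdsWithin_zero {E : Type*} [AddCommGroup E] [Module ℝ E]
    [TopologicalSpace E] [ContinuousSMul ℝ E] {Γ : Set E}
    (hcone : ∀ t : ℝ, 0 < t → ∀ x ∈ Γ, t • x ∈ Γ) {l : E} (hl : l ∈ Γ) :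
    Tendsto (fun s : ℝ => s • l) (nhdsWithin 0 (Ioi 0)) (nhdsWithin 0 Γ) := by
  refine tendsto_nhdsWithin_iff.2 ⟨?_, ?_⟩
  · have h : Continuous fun s : ℝ => s • l := by fun_prop
    exact (by simpa using h.tendsto 0 : Tendsto (fun s : ℝ => s • l) (nhds 0) (nhds 0)).mono_left
      nhdsWithin_le_nhds
  · filter_upwards [self_mem_nhdsWithin] with s hs
    exact hcone s hs l hl

/-- The vertex of a nonempty proper open cone lies on its frontier. -/
theorem zero_mem_frontier_of_cone {E : Type*} [AddCommGroup E] [Module ℝ E]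
    [TopologicalSpace E] [ContinuousSMul ℝ E] {Γ : Set E} (hopen : IsOpen Γ)
    (hcone : ∀ t : ℝ, 0 < t → ∀ x ∈ Γ, t • x ∈ Γ) (hne : Γ.Nonempty) (hproper : Γ ≠ univ) :
    (0 : E) ∈ frontier Γ := by
  rw [hopen.frontier_eq]
  refine ⟨?_, fun h0 => hproper (eq_univ_of_forall fun x => ?_)⟩
  · obtain ⟨l, hl⟩ := hne
    exact mem_closure_iff_nhdsWithin_neBot.2 (tendsto_smul_nhdsWithin_zero hcone hl).neBot
  · have h : Tendsto (fun s : ℝ => s • x) (nhds 0) (nhds 0) := by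
      have hc : Continuous fun s : ℝ => s • x := by fun_prop
      simpa using hc.tendsto 0
    have hev : ∀ᶠ s : ℝ in nhdsWithin 0 (Ioi 0), s • x ∈ Γ :=
      (h.mono_left nhdsWithin_le_nhds).eventually (hopen.mem_nhds h0)
    obtain ⟨s, hsx, hs⟩ := (hev.and self_mem_nhdsWithin).exists
    have hs : 0 < s := hs
    simpa [smul_smul, inv_mul_cancel₀ hs.ne'] using hcone s⁻¹ (inv_pos.2 hs) _ hsx

/-- A continuous concave function on an open cone is bounded above near the vertex. -/
theorem ConcaveOn.isBoundedUnder_le_nhdsWithin_zero {E : Type*} [AddCommGroup E] [Module ℝ E]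
    [TopologicalSpace E] [IsTopologicalAddGroup E] {Γ : Set E} {f : E → ℝ} (hopen : IsOpen Γ)
    (hcone : ∀ t : ℝ, 0 < t → ∀ x ∈ Γ, t • x ∈ Γ) (hconc : ConcaveOn ℝ Γ f)
    (hcont : ContinuousOn f Γ) (hne : Γ.Nonempty) :
    IsBoundedUnder (· ≤ ·) (nhdsWithin (0 : E) Γ) f := by
  obtain ⟨p, hp⟩ := hne
  have h2p : (2 : ℝ) • p ∈ Γ := hcone 2 two_pos p hp
  have hlim : Tendsto (fun x : E => (2 : ℝ) • p - x) (nhds 0) (nhds ((2 : ℝ) • p)) := by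
    have hc : Continuous fun x : E => (2 : ℝ) • p - x := by fun_prop
    simpa using hc.tendsto 0
  have hmem : ∀ᶠ x in nhds (0 : E), (2 : ℝ) • p - x ∈ Γ :=
    hlim.eventually (hopen.mem_nhds h2p)
  have hlow : ∀ᶠ x in nhds (0 : E), f ((2 : ℝ) • p) - 1 < f ((2 : ℝ) • p - x) :=
    hlim.eventually ((hcont.continuousAt (hopen.mem_nhds h2p)).eventually_const_lt (by linarith))
  refine ⟨2 * f p - f ((2 : ℝ) • p) + 1, eventually_map.2 ?_⟩
  filter_upwards [self_mem_nhdsWithin, mem_nhdsWithin_of_mem_nhds hmem,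
    mem_nhdsWithin_of_mem_nhds hlow] with x hx hxm hxl
  have h := hconc.2 hx hxm (by norm_num : (0 : ℝ) ≤ 1 / 2) (by norm_num : (0 : ℝ) ≤ 1 / 2)
    (by norm_num)
  have hmid : (1 / 2 : ℝ) • x + (1 / 2 : ℝ) • ((2 : ℝ) • p - x) = p := by
    module
  rw [hmid] at h
  simp only [smul_eq_mul] at h hxl
  linarith

/-- If `∂Γ^σ ∩ 𝒞_σ = ∅`, then every `λ ∈ Γ` with `f(λ) ≥ σ` belongs to `𝒞_σ⁺`. -/
theorem superlevel_subset_Cplus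
    (n : ℕ) (hn : 2 ≤ n) (Γ : Set (Fin n → ℝ))
    (hΓopen : IsOpen Γ) (hΓconv : Convex ℝ Γ)
    (hΓcone : ∀ t : ℝ, 0 < t → ∀ x ∈ Γ, t • x ∈ Γ)
    (hΓsymm : ∀ π : Equiv.Perm (Fin n), ∀ x ∈ Γ, x ∘ π ∈ Γ)
    (hΓpos : {x : Fin n → ℝ | ∀ i, 0 < x i} ⊆ Γ)
    (hΓproper : Γ ≠ Set.univ) (hΓbd : (frontier Γ).Nonempty)
    (f : (Fin n → ℝ) → ℝ)
    (hf1 : ContDiffOn ℝ 1 f Γ)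
    (hfsymm : ∀ π : Equiv.Perm (Fin n), ∀ x ∈ Γ, f (x ∘ π) = f x)
    (hfpos : ∀ x ∈ Γ, ∀ i, 0 < pd f x i)
    (hfconc : ConcaveOn ℝ Γ f)
    (σ : ℝ)
    (hσ : ∀ μ₀ ∈ frontier Γ, Filter.limsup f (nhdsWithin μ₀ Γ) < σ)
    (hΓσne : {x | x ∈ Γ ∧ σ < f x}.Nonempty)
    (hdisj : ∀ l ∈ Γ, f l = σ → l ∉ Ctan Γ f σ) :
    ∀ l ∈ Γ, σ ≤ f l → l ∈ Cplus Γ f σ := by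
  have hfcont : ContinuousOn f Γ := hf1.continuousOn
  have hnot : ∀ l ∈ Γ, σ ≤ f l → l ∉ Ctan Γ f σ := by
    intro l hl hσl hlC
    have hray : ∀ s : ℝ, 0 < s → f (s • l) ≠ σ := fun s hs hfs =>
      hdisj _ (hΓcone s hs l hl) hfs (smul_mem_Ctan hs hlC)
    have hlt : ∀ᶠ x in nhdsWithin 0 Γ, f x < σ :=
      eventually_lt_of_limsup_lt
        (hσ 0 (zero_mem_frontier_of_cone hΓopen hΓcone ⟨l, hl⟩ hΓproper))
        (hfconc.isBoundedUnder_le_nhdsWithin_zero hΓopen hΓcone hfcont ⟨l, hl⟩)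
    obtain ⟨s, hfs, hs⟩ := (((tendsto_smul_nhdsWithin_zero hΓcone hl).eventually hlt).and
      self_mem_nhdsWithin).exists
    have hcont : ContinuousOn (fun s : ℝ => f (s • l)) (Ioi 0) :=
      hfcont.comp (by fun_prop) fun s hs => hΓcone s hs l hl
    obtain ⟨r, hr, hfr⟩ := isPreconnected_Ioi.intermediate_value hs
      (mem_Ioi.2 one_pos) hcont ⟨hfs.le, by simpa using hσl⟩
    exact hray r hr hfr
  intro l hl hσl
  obtain ⟨y, hy, hσy⟩ := hΓσne
  have hsub : {x ∈ Γ | σ ≤ f x} ⊆ Γ \ Ctan Γ f σ := fun x hx => ⟨hx.1, hnot x hx.1 hx.2⟩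
  exact mem_biUnion (show y ∈ {x | x ∈ Γ ∧ σ < f x} from ⟨hy, hσy⟩)
    ((hfconc.convex_ge σ).isPreconnected.subset_connectedComponentIn ⟨hy, hσy.le⟩ hsub ⟨hl, hσl⟩)
end
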